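/- arXiv:1305.3201 — 2 statements merged into one kernel-verified Lean document; each statement's English description precedes it below -/
import Mathlib

section
/- Let e₁, …, e₅ be complex numbers, and write 4∏_{i=1}^{5}(x − e_i) = 4x⁵ + λ₄x⁴ + λ₃x³ + λ₂x² + λ₁x + λ₀. Let F(x,z) = ∑_{k=0}^{2} xᵏzᵏ(2λ_{2k} + λ_{2k+1}(x+z)) with λ₅ := 4 be the Kleinian 2-polar of the genus-two curve. Then for any two indices i ≠ j in {1,…,5}, with {k,m,n} = {1,…,5} \ {i,j}, one has F(e_i, e_j) = 4(e_i − e_j)² · ( e_i e_j (e_k + e_m + e_n) + e_k e_m e_n ). -/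
/-- A cover of `Fin 5` by five indices lets one expand a product over `Fin 5` along them. -/
theorem prod_eq_of_cover {M : Type*} [CommMonoid M] (f : Fin 5 → M) {i j k m n : Fin 5}
    (hcover : ({i, j, k, m, n} : Finset (Fin 5)) = Finset.univ) :
    ∏ a, f a = f i * f j * f k * f m * f n := by
  have hsurj : Function.Surjective ![i, j, k, m, n] := by
    intro a
    have ha : a ∈ ({i, j, k, m, n} : Finset (Fin 5)) := hcover ▸ Finset.mem_univ a
    simp only [Finset.mem_insert, Finset.mem_singleton] at ha
    rcases ha with rfl | rfl | rfl | rfl | rfl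
    exacts [⟨0, rfl⟩, ⟨1, rfl⟩, ⟨2, rfl⟩, ⟨3, rfl⟩, ⟨4, rfl⟩]
  rw [← Function.Bijective.prod_comp (Finite.injective_iff_bijective.mp
    (Finite.injective_iff_surjective.mpr hsurj)) f, Fin.prod_univ_five]
  rfl

/-- let `e₁, …, e₅ ∈ ℂ` with
`4∏(x − eᵢ) = 4x⁵ + λ₄x⁴ + λ₃x³ + λ₂x² + λ₁x + λ₀`, and let
`F(x,z) = ∑_{k=0}^{2} xᵏzᵏ(2λ_{2k} + λ_{2k+1}(x+z))` (with `λ₅ = 4`) be the Kleinian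
2-polar.  Then for indices `i, j, k, m, n` enumerating `{1,…,5}` (so in particular
`i ≠ j` and `{k,m,n}` is the complementary triple),
`F(eᵢ, eⱼ) = 4(eᵢ − eⱼ)² (eᵢeⱼ(e_k + e_m + e_n) + e_k e_m e_n)`. -/
theorem kleinian_two_polar_at_branch_points (e : Fin 5 → ℂ) (l0 l1 l2 l3 l4 : ℂ)
    (hexp : ∀ x : ℂ, 4 * ∏ i, (x - e i) =
      4 * x ^ 5 + l4 * x ^ 4 + l3 * x ^ 3 + l2 * x ^ 2 + l1 * x + l0)
    (i j k m n : Fin 5)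
    (hcover : ({i, j, k, m, n} : Finset (Fin 5)) = Finset.univ)
    (hij : i ≠ j) :
    (2 * l0 + l1 * (e i + e j))
      + e i * e j * (2 * l2 + l3 * (e i + e j))
      + (e i) ^ 2 * (e j) ^ 2 * (2 * l4 + 4 * (e i + e j)) =
    4 * (e i - e j) ^ 2 *
      (e i * e j * (e k + e m + e n) + e k * e m * e n) := by
  simp only [prod_eq_of_cover _ hcover] at hexp
  generalize e i = x at *
  generalize e j = z at *
  generalize e k = a at *
  generalize e m = b at *
  generalize e n = c at *
  have h0 := hexp 0
  have h1 := hexp 1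
  have h1n := hexp (-1)
  have h2 := hexp 2
  have h2n := hexp (-2)
  have hl0 : l0 = -4 * (x * z * a * b * c) := by linear_combination -h0
  have hl1 : l1 = 4 * (x * z * (a * b + b * c + c * a) + (x + z) * (a * b * c)) := by
    linear_combination (-8 * (h1 - h1n) + (h2 - h2n)) / 12
  have hl2 : l2 = -4 * (x * z * (a + b + c) + (x + z) * (a * b + b * c + c * a) + a * b * c) := by
    linear_combination (-16 * (h1 + h1n) + (h2 + h2n) + 30 * h0) / 24
  have hl3 : l3 = 4 * (x * z + (x + z) * (a + b + c) + (a * b + b * c + c * a)) := by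
    linear_combination (2 * (h1 - h1n) - (h2 - h2n)) / 12
  have hl4 : l4 = -4 * (x + z + a + b + c) := by
    linear_combination (4 * (h1 + h1n) - (h2 + h2n) - 6 * h0) / 24
  rw [hl0, hl1, hl2, hl3, hl4]
  ring
end

section
/- Let τ ∈ ℂ with Im τ > 0, and define the four Jacobi theta functions of z ∈ ℂ by θ₁(z) = θ[1/2,1/2](z;τ), θ₂(z) = θ[1/2,0](z;τ), θ₃(z) = θ[0,0](z;τ), θ₄(z) = θ[0,1/2](z;τ), where θ[ε,ε'](z;τ) = ∑_{n∈ℤ} exp(iπ(n+ε)²τ + 2iπ(n+ε)(z+ε')). Then, with primes denoting derivatives in z evaluated at z = 0, the Weierstrass identity θ₁'''(0)·θ₂(0)θ₃(0)θ₄(0) = θ₁'(0)·( θ₂''(0)θ₃(0)θ₄(0) + θ₂(0)θ₃''(0)θ₄(0) + θ₂(0)θ₃(0)θ₄''(0) ) holds; equivalently θ₁'''(0)/θ₁'(0) = θ₂''(0)/θ₂(0) + θ₃''(0)/θ₃(0) + θ₄''(0)/θ₄(0). -/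
open Complex

/-- The genus-one theta function with real characteristics `ε, ε'`:
`θ[ε,ε'](z;τ) = ∑_{n∈ℤ} exp(iπ(n+ε)²τ + 2iπ(n+ε)(z+ε'))`. -/
noncomputable def jacobiThetaChar (τ : ℂ) (ε ε' : ℝ) (z : ℂ) : ℂ :=
  ∑' n : ℤ,
    Complex.exp ((Real.pi : ℂ) * Complex.I * ((n : ℂ) + (ε : ℂ)) ^ 2 * τ
      + 2 * (Real.pi : ℂ) * Complex.I * ((n : ℂ) + (ε : ℂ)) * (z + (ε' : ℂ)))

theorem jacobiThetaChar_term_eq (τ : ℂ) (a b : ℝ) (z : ℂ) (n : ℤ) :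
    cexp (Real.pi * I * (n + a) ^ 2 * τ + 2 * Real.pi * I * (n + a) * (z + b)) =
      cexp (Real.pi * I * a ^ 2 * τ + 2 * Real.pi * I * a * (z + b)) *
        jacobiTheta₂_term n (z + b + a * τ) τ := by
  rw [jacobiTheta₂_term, ← Complex.exp_add]
  congr 1
  ring

theorem jacobiThetaChar_eq_exp_mul_jacobiTheta₂ (τ : ℂ) (a b : ℝ) (z : ℂ) :
    jacobiThetaChar τ a b z =
      cexp (Real.pi * I * a ^ 2 * τ + 2 * Real.pi * I * a * (z + b)) *
        jacobiTheta₂ (z + b + a * τ) τ := by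
  simp only [jacobiThetaChar, jacobiThetaChar_term_eq, tsum_mul_left, jacobiTheta₂]

theorem summable_jacobiThetaChar_term {τ : ℂ} (hτ : 0 < τ.im) (a b : ℝ) (z : ℂ) :
    Summable fun n : ℤ ↦
      cexp (Real.pi * I * (n + a) ^ 2 * τ + 2 * Real.pi * I * (n + a) * (z + b)) := by
  simp only [jacobiThetaChar_term_eq]
  exact ((summable_jacobiTheta₂_term_iff _ τ).mpr hτ).mul_left _

theorem differentiable_jacobiThetaChar {τ : ℂ} (hτ : 0 < τ.im) (a b : ℝ) :
    Differentiable ℂ (jacobiThetaChar τ a b) := by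
  rw [funext (jacobiThetaChar_eq_exp_mul_jacobiTheta₂ τ a b)]
  intro z
  refine DifferentiableAt.mul (by fun_prop) ?_
  exact (differentiableAt_jacobiTheta₂_fst (z + b + a * τ) hτ).comp z
    (f := fun z ↦ z + b + a * τ) (by fun_prop)

theorem jacobiThetaChar_eq_add (τ : ℂ) (a b : ℝ) (z : ℂ) :
    jacobiThetaChar τ a b z = jacobiThetaChar τ a 0 (z + b) := by
  simp [jacobiThetaChar]

theorem jacobiThetaChar_neg (τ : ℂ) (a b : ℝ) (z : ℂ) :
    jacobiThetaChar τ a b (-z) = jacobiThetaChar τ (-a) (-b) z := by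
  rw [jacobiThetaChar, ← (Equiv.neg ℤ).tsum_eq]
  refine tsum_congr fun n ↦ congrArg cexp ?_
  simp only [Equiv.neg_apply]
  push_cast
  ring

theorem jacobiThetaChar_add_one_left (τ : ℂ) (a b : ℝ) (z : ℂ) :
    jacobiThetaChar τ (a + 1) b z = jacobiThetaChar τ a b z := by
  rw [jacobiThetaChar, jacobiThetaChar, ← (Equiv.subRight (1 : ℤ)).tsum_eq]
  refine tsum_congr fun n ↦ congrArg cexp ?_
  simp only [Equiv.subRight_apply]
  push_cast
  ring

theorem jacobiThetaChar_add_one (τ : ℂ) (a b : ℝ) (z : ℂ) :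
    jacobiThetaChar τ a b (z + 1) = cexp (2 * Real.pi * I * a) * jacobiThetaChar τ a b z := by
  rw [jacobiThetaChar, jacobiThetaChar, ← tsum_mul_left]
  refine tsum_congr fun n ↦ ?_
  rw [← Complex.exp_add, Complex.exp_eq_exp_iff_exists_int]
  exact ⟨n, by ring⟩

theorem sumDiff_bijective : Function.Bijective
    (Sum.elim (fun p : ℤ × ℤ ↦ (p.1 + p.2, p.1 - p.2))
      (fun p : ℤ × ℤ ↦ (p.1 + p.2 + 1, p.1 - p.2))) := by
  constructor
  · rintro (⟨p, q⟩ | ⟨p, q⟩) (⟨r, s⟩ | ⟨r, s⟩) h <;>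
      simp only [Sum.elim_inl, Sum.elim_inr, Prod.mk.injEq, Sum.inl.injEq, Sum.inr.injEq,
        reduceCtorEq] at h ⊢ <;> omega
  · rintro ⟨n, m⟩
    rcases Int.even_or_odd' (n + m) with ⟨k, hk | hk⟩
    · exact ⟨.inl (k, n - k), by simp only [Sum.elim_inl, Prod.mk.injEq]; omega⟩
    · exact ⟨.inr (k, n - k - 1), by simp only [Sum.elim_inr, Prod.mk.injEq]; omega⟩

/-- The addition formula expressing a product of two theta functions of modulus `τ` through theta
functions of modulus `2τ`. -/
theorem jacobiThetaChar_mul {τ : ℂ} (hτ : 0 < τ.im) (a b : ℝ) (x y : ℂ) :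
    jacobiThetaChar τ a 0 x * jacobiThetaChar τ b 0 y =
      jacobiThetaChar (2 * τ) ((a + b) / 2) 0 (x + y) *
          jacobiThetaChar (2 * τ) ((a - b) / 2) 0 (x - y) +
        jacobiThetaChar (2 * τ) ((a + b + 1) / 2) 0 (x + y) *
          jacobiThetaChar (2 * τ) ((a - b + 1) / 2) 0 (x - y) := by
  have h2τ : 0 < (2 * τ).im := by simpa using hτ
  have hs := fun c z ↦ (summable_jacobiThetaChar_term hτ c 0 z).norm
  have hs2 := fun c z ↦ (summable_jacobiThetaChar_term h2τ c 0 z).norm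
  have hprod := summable_mul_of_summable_norm (hs a x) (hs b y)
  let e := Equiv.ofBijective _ sumDiff_bijective
  simp only [jacobiThetaChar]
  rw [tsum_mul_tsum_of_summable_norm (hs a x) (hs b y),
    tsum_mul_tsum_of_summable_norm (hs2 _ _) (hs2 _ _),
    tsum_mul_tsum_of_summable_norm (hs2 _ _) (hs2 _ _), ← e.tsum_eq]
  have hsum := e.summable_iff.mpr hprod
  refine (Summable.tsum_sum (hsum.comp_injective Sum.inl_injective)
    (hsum.comp_injective Sum.inr_injective)).trans ?_
  congr 1 <;>
  · refine tsum_congr fun p ↦ ?_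
    simp only [e, Function.comp_apply, Equiv.ofBijective_apply, Sum.elim_inl, Sum.elim_inr, ← Complex.exp_add]
    congr 1
    push_cast
    ring

theorem jacobiThetaChar_half_add_one (τ : ℂ) (b : ℝ) (z : ℂ) :
    jacobiThetaChar τ (1 / 2) b (z + 1) = -jacobiThetaChar τ (1 / 2) b z := by
  have hexp : cexp (2 * Real.pi * I * ((1 / 2 : ℝ) : ℂ)) = -1 := by
    rw [← Complex.exp_pi_mul_I]
    congr 1
    push_cast
    ring
  rw [jacobiThetaChar_add_one, hexp, neg_one_mul]

theorem jacobiThetaChar_half_neg (τ : ℂ) (z : ℂ) :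
    jacobiThetaChar τ (1 / 2) 0 (-z) = jacobiThetaChar τ (1 / 2) 0 z := by
  rw [jacobiThetaChar_neg, neg_zero, ← jacobiThetaChar_add_one_left]
  norm_num

theorem jacobiThetaChar_half (τ : ℂ) : jacobiThetaChar τ (1 / 2) 0 (1 / 2) = 0 := by
  have h := jacobiThetaChar_half_add_one τ 0 (-(1 / 2))
  rw [jacobiThetaChar_half_neg, show -(1 / 2) + 1 = (1 / 2 : ℂ) by norm_num] at h
  exact self_eq_neg.mp h

/-- The duplication formula
`θ₁(2z) θ₂(0) θ₃(0) θ₄(0) = 2 θ₁(z) θ₂(z) θ₃(z) θ₄(z)`. -/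
theorem jacobiThetaChar_two_mul {τ : ℂ} (hτ : 0 < τ.im) (z : ℂ) :
    jacobiThetaChar τ (1 / 2) (1 / 2) (2 * z) *
        (jacobiThetaChar τ (1 / 2) 0 0 * (jacobiThetaChar τ 0 0 0 * jacobiThetaChar τ 0 (1 / 2) 0)) =
      2 * (jacobiThetaChar τ (1 / 2) (1 / 2) z * (jacobiThetaChar τ (1 / 2) 0 z *
        (jacobiThetaChar τ 0 0 z * jacobiThetaChar τ 0 (1 / 2) z))) := by
  set A := jacobiThetaChar (2 * τ) (1 / 2) 0 with hA
  set B := jacobiThetaChar (2 * τ) 0 0 with hB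
  have hB1 : jacobiThetaChar (2 * τ) 1 0 = B := by
    ext w
    simpa using jacobiThetaChar_add_one_left (2 * τ) 0 0 w
  have hA12 : A (1 / 2) = 0 := jacobiThetaChar_half _
  have hA0 : A (-(1 / 2)) = 0 := (jacobiThetaChar_half_neg _ _).trans hA12
  have hBneg : B (-(1 / 2)) = B (1 / 2) := by
    simpa using jacobiThetaChar_neg (2 * τ) 0 0 (1 / 2)
  have h12 (x y : ℂ) : jacobiThetaChar τ (1 / 2) (1 / 2) x * jacobiThetaChar τ (1 / 2) 0 y =
      A (x + y + 1 / 2) * B (x - y + 1 / 2) + B (x + y + 1 / 2) * A (x - y + 1 / 2) := by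
    have h := jacobiThetaChar_mul hτ (1 / 2) (1 / 2) (x + 1 / 2) y
    rw [jacobiThetaChar_eq_add τ (1 / 2) (1 / 2)]
    norm_num at h hA hB hB1 ⊢
    rw [h, hB1, add_right_comm, add_sub_right_comm, hA]
  have h34 (x : ℂ) : jacobiThetaChar τ 0 0 x * jacobiThetaChar τ 0 (1 / 2) x =
      B (2 * x + 1 / 2) * B (1 / 2) := by
    have h := jacobiThetaChar_mul hτ 0 0 x (x + 1 / 2)
    have e1 : x + (x + 1 / 2) = 2 * x + 1 / 2 := by ring
    have e2 : x - (x + 1 / 2) = -(1 / 2) := by ring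
    rw [e1, e2] at h
    simp only [add_zero, sub_zero, zero_add, zero_div, ← hA, ← hB, hA0, hBneg, mul_zero] at h
    rw [jacobiThetaChar_eq_add τ 0 (1 / 2)]
    simpa using h
  have hz := h12 z z
  have h2z := h12 (2 * z) 0
  have k0 := h34 0
  simp only [sub_self, zero_add, add_zero, sub_zero, mul_zero, ← two_mul] at hz h2z k0
  rw [hA12] at hz
  rw [k0, ← mul_assoc, h2z, h34, ← mul_assoc (jacobiThetaChar τ (1 / 2) (1 / 2) z), hz]
  ring

theorem deriv_zero_of_even {f : ℂ → ℂ} (h : ∀ z, f (-z) = f z) : deriv f 0 = 0 := by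
  have h' : deriv (fun z ↦ f (-z)) 0 = deriv f 0 := by rw [funext h]
  rw [deriv_comp_neg, neg_zero] at h'
  grind

theorem iteratedDeriv_three_of_duplication {f g₂ g₃ g₄ : ℂ → ℂ} (hf : ContDiff ℂ 3 f)
    (hg₂ : ContDiff ℂ 3 g₂) (hg₃ : ContDiff ℂ 3 g₃) (hg₄ : ContDiff ℂ 3 g₄)
    (hf0 : f 0 = 0) (h₂ : deriv g₂ 0 = 0) (h₃ : deriv g₃ 0 = 0) (h₄ : deriv g₄ 0 = 0)
    (h : ∀ z, f (2 * z) * (g₂ 0 * (g₃ 0 * g₄ 0)) = 2 * (f z * (g₂ z * (g₃ z * g₄ z)))) :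
    iteratedDeriv 3 f 0 * g₂ 0 * g₃ 0 * g₄ 0 =
      deriv f 0 * (iteratedDeriv 2 g₂ 0 * g₃ 0 * g₄ 0 + g₂ 0 * iteratedDeriv 2 g₃ 0 * g₄ 0
        + g₂ 0 * g₃ 0 * iteratedDeriv 2 g₄ 0) := by
  have key := congrArg (fun F ↦ iteratedDeriv 3 F 0) (funext h)
  have le (n : ℕ) (hn : n ≤ 3) {k : ℂ → ℂ} (hk : ContDiff ℂ 3 k) : ContDiffAt ℂ n k 0 :=
    (hk.of_le (by exact_mod_cast hn)).contDiffAt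
  have h34 := hg₃.mul hg₄
  have h234 := hg₂.mul h34
  have e34 (n : ℕ) (hn : n ≤ 3) := iteratedDeriv_fun_mul (le n hn hg₃) (le n hn hg₄)
  have e234 (n : ℕ) (hn : n ≤ 3) := iteratedDeriv_fun_mul (le n hn hg₂) (le n hn h34)
  have ef := iteratedDeriv_fun_mul (le 3 le_rfl hf) (le 3 le_rfl h234)
  simp only [iteratedDeriv_const_mul_field, iteratedDeriv_mul_const_field,
    iteratedDeriv_comp_const_mul hf, ef] at key
  simp [Finset.sum_range_succ, e234, e34, hf0, h₂, h₃, h₄, iteratedDeriv_one] at key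
  linear_combination key / 6

/-- for `τ` in the upper half-plane, with
`θ₁ = θ[1/2,1/2]`, `θ₂ = θ[1/2,0]`, `θ₃ = θ[0,0]`, `θ₄ = θ[0,1/2]`, the Weierstrass
identity `θ₁'''(0)·θ₂(0)θ₃(0)θ₄(0) = θ₁'(0)·(θ₂''(0)θ₃(0)θ₄(0) + θ₂(0)θ₃''(0)θ₄(0)
+ θ₂(0)θ₃(0)θ₄''(0))` holds, i.e.
`θ₁'''(0)/θ₁'(0) = θ₂''(0)/θ₂(0) + θ₃''(0)/θ₃(0) + θ₄''(0)/θ₄(0)`. -/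
theorem weierstrass_theta_identity (τ : ℂ) (hτ : 0 < τ.im) :
    iteratedDeriv 3 (jacobiThetaChar τ (1/2) (1/2)) 0
        * jacobiThetaChar τ (1/2) 0 0
        * jacobiThetaChar τ 0 0 0
        * jacobiThetaChar τ 0 (1/2) 0 =
      deriv (jacobiThetaChar τ (1/2) (1/2)) 0 *
        (iteratedDeriv 2 (jacobiThetaChar τ (1/2) 0) 0
            * jacobiThetaChar τ 0 0 0 * jacobiThetaChar τ 0 (1/2) 0
          + jacobiThetaChar τ (1/2) 0 0
            * iteratedDeriv 2 (jacobiThetaChar τ 0 0) 0 * jacobiThetaChar τ 0 (1/2) 0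
          + jacobiThetaChar τ (1/2) 0 0
            * jacobiThetaChar τ 0 0 0 * iteratedDeriv 2 (jacobiThetaChar τ 0 (1/2)) 0) := by
  have hdiff (a b : ℝ) : ContDiff ℂ 3 (jacobiThetaChar τ a b) :=
    (differentiable_jacobiThetaChar hτ a b).contDiff
  refine iteratedDeriv_three_of_duplication (hdiff _ _) (hdiff _ _) (hdiff _ _) (hdiff _ _)
    ?_ (deriv_zero_of_even fun z ↦ ?_) (deriv_zero_of_even fun z ↦ ?_)
    (deriv_zero_of_even fun z ↦ ?_) (jacobiThetaChar_two_mul hτ)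
  · rw [jacobiThetaChar_eq_add, zero_add]
    simpa using jacobiThetaChar_half τ
  · exact jacobiThetaChar_half_neg τ z
  · rw [jacobiThetaChar_neg, neg_zero]
  · have hper := jacobiThetaChar_add_one τ 0 0 (z - 1 / 2)
    rw [jacobiThetaChar_neg, neg_zero, jacobiThetaChar_eq_add τ 0 (-(1 / 2)),
      jacobiThetaChar_eq_add τ 0 (1 / 2)]
    have e : z - 1 / 2 + 1 = z + 1 / 2 := by ring
    rw [e] at hper
    simpa [sub_eq_add_neg] using hper.symm
end
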